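/- Let t0 ≥ 0, σ > 0, τ > 0, and let a, b, g, h : ℝ → ℝ be Lebesgue measurable with 0 ≤ t − g(t) ≤ σ and 0 ≤ t − h(t) ≤ τ for almost every t ≥ t0. Suppose there exist constants b0 > 0, B > 0, A0 ∈ [0,1), R ≥ 0 and S ≥ 0 such that for almost every t ≥ t0: b0 ≤ b(t) ≤ B, |a(t)| ≤ A0, |a(t)|/b(t) ≤ R and max{ t − h(t) − 1/(B·e), 0 } ≤ S, and that B·(R + S) < 1 − A0. Then the neutral equation x'(t) − a(t)x'(g(t)) = −b(t)·x(h(t)) is uniformly exponentially stable for initial times in [t0,∞). -/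

import Mathlib

open MeasureTheory Real

/-- The extended derivative: `deriv x t` for `t ≥ s`, the prescribed initial
derivative `ψ t` for `t < s`. -/
noncomputable def Dfun (x ψ : ℝ → ℝ) (s : ℝ) : ℝ → ℝ :=
  fun t => if s ≤ t then deriv x t else ψ t

/-- A function `f : ℝ → ℝ` is (globally) bounded. -/
def Bdd (f : ℝ → ℝ) : Prop := ∃ C : ℝ, ∀ u : ℝ, |f u| ≤ C

/-- `x` is a solution on `[s,∞)` of the neutral equation
`x'(t) - a(t) x'(g(t)) = -b(t) x(h(t))` with initial data `(φ, ψ)`. -/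
def IsNeutralSolution1 (a b g h : ℝ → ℝ) (s : ℝ) (φ ψ x : ℝ → ℝ) : Prop :=
  (∀ t ≤ s, x t = φ t) ∧
  (∀ t, s ≤ t → DifferentiableAt ℝ x t) ∧
  (∀ t1, s ≤ t1 → ∃ C : ℝ, ∀ t ∈ Set.Icc s t1, |deriv x t| ≤ C) ∧
  (∀ᵐ t : ℝ ∂volume, s ≤ t →
    Dfun x ψ s t - a t * Dfun x ψ s (g t) = -(b t * x (h t)))

/-- Uniform exponential stability of the neutral equation
`x'(t) - a(t) x'(g(t)) = -b(t) x(h(t))` for initial times in `[t0,∞)`. -/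
def UnifExpStable1 (a b g h : ℝ → ℝ) (t0 : ℝ) : Prop :=
  ∃ M > (0:ℝ), ∃ γ > (0:ℝ), ∀ s, t0 ≤ s → ∀ φ ψ x : ℝ → ℝ, Bdd φ → Bdd ψ →
    IsNeutralSolution1 a b g h s φ ψ x →
    ∀ t, s ≤ t →
      |x t| ≤ M * Real.exp (-γ * (t - s)) * ⨆ u : {u : ℝ // u ≤ s}, (|φ u.1| + |ψ u.1|)


/-- The derivative of an everywhere differentiable function is interval integrable when bounded. -/
lemma aux_intInt (f : ℝ → ℝ) (u t C : ℝ) (hut : u ≤ t)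
    (hC : ∀ v ∈ Set.Icc u t, |deriv f v| ≤ C) :
    IntervalIntegrable (deriv f) volume u t := by
  have h1 : IntervalIntegrable (fun _ : ℝ => C) volume u t := intervalIntegrable_const
  refine h1.mono_fun (measurable_deriv f).aestronglyMeasurable ?_
  refine (ae_restrict_mem measurableSet_uIoc).mono ?_
  intro v hv
  rw [Set.uIoc_of_le hut] at hv
  have := hC v ⟨hv.1.le, hv.2⟩
  simp only [Real.norm_eq_abs]
  exact this.trans (le_abs_self C)

lemma aux_anti (f : ℝ → ℝ) (u t C : ℝ) (hut : u ≤ t)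
    (hd : ∀ v ∈ Set.Icc u t, DifferentiableAt ℝ f v)
    (hC : ∀ v ∈ Set.Icc u t, |deriv f v| ≤ C)
    (hneg : ∀ᵐ v : ℝ ∂volume, v ∈ Set.Icc u t → deriv f v ≤ 0) : f t ≤ f u := by
  have hi := aux_intInt f u t C hut hC
  have h1 : ∫ v in u..t, deriv f v = f t - f u := by
    apply intervalIntegral.integral_eq_sub_of_hasDerivAt _ hi
    intro v hv
    rw [Set.uIcc_of_le hut] at hv
    exact (hd v hv).hasDerivAt
  have h2 : ∫ v in u..t, deriv f v ≤ ∫ _v in u..t, (0:ℝ) := by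
    apply intervalIntegral.integral_mono_ae_restrict hut hi intervalIntegrable_const
    rw [Filter.EventuallyLE, ae_restrict_iff' measurableSet_Icc]
    exact hneg
  simp at h2
  linarith

/-- Positivity (nonoscillation) lemma. -/
lemma aux_pos (z : ℝ → ℝ) (s T C B : ℝ) (hB : 0 < B)
    (hd : ∀ v ∈ Set.Icc s T, DifferentiableAt ℝ z v)
    (hC : ∀ v ∈ Set.Icc s T, |deriv z v| ≤ C) (hs : 0 ≤ z s)
    (hae : ∀ᵐ v : ℝ ∂volume, v ∈ Set.Icc s T → ∃ r β : ℝ, s ≤ r ∧ r ≤ v ∧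
      v - r ≤ 1 / (B * Real.exp 1) ∧ 0 ≤ β ∧ β ≤ B ∧ 0 ≤ deriv z v + β * z r) :
    ∀ t ∈ Set.Icc s T, 0 ≤ z t := by
  intro t ht
  set k : ℝ := Real.exp 1 * B with hk
  have hkpos : 0 < k := by positivity
  have hcont : ContinuousOn (fun v => z v * Real.exp (k * v)) (Set.Icc s t) := by
    intro v hv
    have := (hd v ⟨hv.1, hv.2.trans ht.2⟩).continuousAt
    exact (this.mul (by fun_prop)).continuousWithinAt
  obtain ⟨u, hu, hmax⟩ := isCompact_Icc.exists_isMaxOn (Set.nonempty_Icc.2 ht.1) hcont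
  set c := z u * Real.exp (k * u) with hc
  have hle : ∀ v ∈ Set.Icc s t, z v * Real.exp (k * v) ≤ c := fun v hv => hmax hv
  clear_value c
  have hc0 : 0 ≤ c := by
    have := hle s ⟨le_rfl, ht.1⟩
    have h2 : 0 ≤ z s * Real.exp (k * s) := by positivity
    linarith
  have hder : ∀ v, HasDerivAt (fun v => c * Real.exp (-k * v)) (c * (Real.exp (-k * v) * (-k))) v := by
    intro v
    have h1 : HasDerivAt (fun v : ℝ => -k * v) (-k) v := by
      simpa using (hasDerivAt_id v).const_mul (-k)
    exact (h1.exp).const_mul c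
  have hderq : ∀ v ∈ Set.Icc u t, HasDerivAt (fun v => c * Real.exp (-k * v) - z v)
      (c * (Real.exp (-k * v) * (-k)) - deriv z v) v := by
    intro v hv
    exact (hder v).sub (hd v ⟨hu.1.trans hv.1, hv.2.trans ht.2⟩).hasDerivAt
  have key := aux_anti (fun v => c * Real.exp (-k * v) - z v) u t
    (c * (Real.exp (-k * u) * k) + C) hu.2 (fun v hv => (hderq v hv).differentiableAt) ?_ ?_
  · have e1 : c * Real.exp (-k * u) = z u := by
      rw [hc, mul_assoc, ← Real.exp_add]; simp
    have h3 : 0 ≤ c * Real.exp (-k * t) := by positivity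
    linarith
  · intro v hv
    rw [(hderq v hv).deriv]
    have h1 := hC v ⟨hu.1.trans hv.1, hv.2.trans ht.2⟩
    have h2 : Real.exp (-k * v) ≤ Real.exp (-k * u) := by
      apply Real.exp_le_exp.2
      nlinarith [hv.1]
    have h3 : |c * (Real.exp (-k * v) * (-k))| ≤ c * (Real.exp (-k * u) * k) := by
      rw [abs_mul, abs_mul, abs_neg, abs_of_nonneg hc0, abs_of_pos hkpos, abs_of_pos (Real.exp_pos _)]
      gcongr
    exact (abs_sub _ _).trans (add_le_add h3 h1)
  · filter_upwards [hae] with v hv hvm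
    rw [(hderq v hvm).deriv]
    obtain ⟨r, β, hr1, hr2, hr3, hβ0, hβB, hineq⟩ := hv ⟨hu.1.trans hvm.1, hvm.2.trans ht.2⟩
    have h1 := hle r ⟨hr1, hr2.trans hvm.2⟩
    have h2 : z r ≤ c * Real.exp (-k * r) := by
      have := mul_le_mul_of_nonneg_right h1 (Real.exp_pos (-k * r)).le
      rw [mul_assoc, ← Real.exp_add] at this
      simpa using this
    have h3 : Real.exp (-k * r) ≤ Real.exp (-k * v) * Real.exp 1 := by
      rw [← Real.exp_add]
      apply Real.exp_le_exp.2
      have : k * (v - r) ≤ 1 := by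
        calc k * (v - r) ≤ k * (1 / (B * Real.exp 1)) := by gcongr
          _ = 1 := by rw [hk]; field_simp
      linarith
    have h4 : β * z r ≤ B * (c * (Real.exp (-k * v) * Real.exp 1)) := by
      calc β * z r ≤ β * (c * Real.exp (-k * r)) := by gcongr
        _ ≤ B * (c * (Real.exp (-k * v) * Real.exp 1)) := by gcongr
    have h5 : c * (Real.exp (-k * v) * (-k)) = - (B * (c * (Real.exp (-k * v) * Real.exp 1))) := by
      rw [hk]; ring
    linarith

/-- An almost everywhere exponential bound on the derivative holds everywhere. -/
lemma aux_everywhere (x : ℝ → ℝ) (s T C K γ : ℝ) (hsT : s < T) (hγ : 0 < γ)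
    (hd : ∀ v ∈ Set.Icc s T, DifferentiableAt ℝ x v)
    (hC : ∀ v ∈ Set.Icc s T, |deriv x v| ≤ C)
    (hae : ∀ᵐ v : ℝ ∂volume, v ∈ Set.Icc s T → deriv x v ≤ K * Real.exp (-γ * (v - s))) :
    ∀ t ∈ Set.Icc s T, deriv x t ≤ K * Real.exp (-γ * (t - s)) := by
  have hder : ∀ v, HasDerivAt (fun v => (-K / γ) * Real.exp (-γ * (v - s)))
      (K * Real.exp (-γ * (v - s))) v := by
    intro v
    have h1 : HasDerivAt (fun v : ℝ => -γ * (v - s)) (-γ) v := by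
      simpa using ((hasDerivAt_id v).sub_const s).const_mul (-γ)
    have e : K * Real.exp (-γ * (v - s)) = (-K / γ) * (Real.exp (-γ * (v - s)) * (-γ)) := by
      have := hγ.ne'
      field_simp
    rw [e]
    exact (h1.exp).const_mul (-K / γ)
  have hderq : ∀ v ∈ Set.Icc s T, HasDerivAt (fun v => x v - (-K / γ) * Real.exp (-γ * (v - s)))
      (deriv x v - K * Real.exp (-γ * (v - s))) v := by
    intro v hv
    exact (hd v hv).hasDerivAt.sub (hder v)
  have hanti : AntitoneOn (fun v => x v - (-K / γ) * Real.exp (-γ * (v - s))) (Set.Icc s T) := by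
    intro u hu t ht hut
    have hsub : ∀ v ∈ Set.Icc u t, v ∈ Set.Icc s T :=
      fun v hv => ⟨hu.1.trans hv.1, hv.2.trans ht.2⟩
    refine aux_anti (fun v => x v - (-K / γ) * Real.exp (-γ * (v - s))) u t (C + |K|) hut
      (fun v hv => (hderq v (hsub v hv)).differentiableAt) ?_ ?_
    · intro v hv
      rw [(hderq v (hsub v hv)).deriv]
      refine (abs_sub _ _).trans (add_le_add (hC v (hsub v hv)) ?_)
      rw [abs_mul, abs_of_pos (Real.exp_pos _)]
      have : Real.exp (-γ * (v - s)) ≤ 1 := by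
        apply Real.exp_le_one_iff.2
        nlinarith [(hsub v hv).1]
      exact mul_le_of_le_one_right (abs_nonneg _) this
    · filter_upwards [hae] with v hv hvm
      rw [(hderq v (hsub v hvm)).deriv]
      linarith [hv (hsub v hvm)]
  intro t ht
  have h1 := hanti.derivWithin_nonpos (x := t)
  rw [(hderq t ht).hasDerivWithinAt.derivWithin (uniqueDiffOn_Icc hsT t ht)] at h1
  linarith

/-- Choice of the decay rate. -/
lemma aux_gamma (σ τ b0 B A0 R S : ℝ) (hb0 : 0 < b0) (hcond : B * (R + S) < 1 - A0) :
    ∃ γ > (0:ℝ), γ < b0 ∧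
      (Real.exp (γ * (σ + τ)) / (1 - γ / b0)) ^ 2 * (B * (R + S)) +
      (Real.exp (γ * (σ + τ)) / (1 - γ / b0)) * A0 < 1 := by
  have hc : ContinuousAt (fun γ : ℝ => (Real.exp (γ * (σ + τ)) / (1 - γ / b0)) ^ 2 * (B * (R + S)) +
      (Real.exp (γ * (σ + τ)) / (1 - γ / b0)) * A0) 0 := by
    have : ContinuousAt (fun γ : ℝ => Real.exp (γ * (σ + τ)) / (1 - γ / b0)) 0 := by
      apply ContinuousAt.div (by fun_prop) (by fun_prop)
      simp
    fun_prop
  have h1 := hc.eventually_lt (continuousAt_const (y := (1:ℝ))) (by simp; linarith)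
  have h2 : ∀ᶠ γ : ℝ in nhds 0, γ < b0 := eventually_lt_nhds hb0
  have h3 := (h1.and h2).filter_mono (nhdsWithin_le_nhds (s := Set.Ioi 0))
  obtain ⟨γ, hγ, hγ0⟩ := (h3.and self_mem_nhdsWithin).exists
  exact ⟨γ, hγ0, hγ.2, hγ.1⟩


/-- Lipschitz estimate from a derivative bound. -/
lemma aux_lip (x : ℝ → ℝ) (u v K : ℝ) (huv : u ≤ v)
    (hd : ∀ w ∈ Set.Icc u v, DifferentiableAt ℝ x w)
    (hK : ∀ w ∈ Set.Icc u v, |deriv x w| ≤ K) : |x v - x u| ≤ K * (v - u) := by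
  have := Convex.norm_image_sub_le_of_norm_deriv_le (f := x) (s := Set.Icc u v) (C := K)
    (x := u) (y := v) hd hK (convex_Icc u v) ⟨le_rfl, huv⟩ ⟨huv, le_rfl⟩
  simpa [Real.norm_eq_abs, abs_of_nonneg (sub_nonneg.2 huv)] using this

set_option maxHeartbeats 1000000 in
lemma aux_core (t0 σ τ : ℝ) (hσ : 0 < σ) (hτ : 0 < τ)
    (a b g h : ℝ → ℝ)
    (hgdel : ∀ᵐ t : ℝ ∂volume, t0 ≤ t → 0 ≤ t - g t ∧ t - g t ≤ σ)
    (hhdel : ∀ᵐ t : ℝ ∂volume, t0 ≤ t → 0 ≤ t - h t ∧ t - h t ≤ τ)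
    (b0 B A0 R S : ℝ) (hb0 : 0 < b0) (hB : 0 < B) (hA0 : 0 ≤ A0)
    (hR : 0 ≤ R) (hS : 0 ≤ S)
    (hae : ∀ᵐ t : ℝ ∂volume, t0 ≤ t →
      b0 ≤ b t ∧ b t ≤ B ∧ |a t| ≤ A0 ∧ |a t| / b t ≤ R ∧
      max (t - h t - 1 / (B * Real.exp 1)) 0 ≤ S)
    (γ ν : ℝ) (hγ : 0 < γ) (hγb : γ < b0)
    (hν : ν = Real.exp (γ * (σ + τ)) / (1 - γ / b0))
    (s : ℝ) (hs : t0 ≤ s) (φ ψ x : ℝ → ℝ) (N : ℝ)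
    (hφ : ∀ u ≤ s, |φ u| ≤ N) (hψ : ∀ u ≤ s, |ψ u| ≤ N)
    (hx : IsNeutralSolution1 a b g h s φ ψ x) (T : ℝ) (hT : s < T) :
    ∃ X Y : ℝ, (∀ t ∈ Set.Icc s T, |x t| ≤ X * Real.exp (-γ * (t - s))) ∧
      0 ≤ Y ∧
      Y ≤ ν * (A0 * Y + B * X + (A0 + B) * N) ∧
      X ≤ ν * ((R + S) * Y + (R + 3) * N) := by
  obtain ⟨hx1, hx2, hx3, hx4⟩ := hx
  have hN : 0 ≤ N := (abs_nonneg _).trans (hφ s le_rfl)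
  obtain ⟨C, hC⟩ := hx3 T hT.le
  have hd : ∀ v ∈ Set.Icc s T, DifferentiableAt ℝ x v := fun v hv => hx2 v hv.1
  -- the weighted suprema
  have hsm : s ∈ Set.Icc s T := ⟨le_rfl, hT.le⟩
  have hXex : ∃ X, IsLUB ((fun t => |x t| * Real.exp (γ * (t - s))) '' Set.Icc s T) X := by
    apply Real.exists_isLUB
    · exact ⟨_, Set.mem_image_of_mem _ hsm⟩
    · apply IsCompact.bddAbove_image isCompact_Icc
      intro v hv
      have := (hd v hv).continuousAt
      exact (this.abs.mul (by fun_prop)).continuousWithinAt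
  have hYex : ∃ Y, IsLUB ((fun t => |deriv x t| * Real.exp (γ * (t - s))) '' Set.Icc s T) Y := by
    apply Real.exists_isLUB
    · exact ⟨_, Set.mem_image_of_mem _ hsm⟩
    · refine ⟨C * Real.exp (γ * (T - s)), ?_⟩
      rintro _ ⟨v, hv, rfl⟩
      have h1 := hC v hv
      have h0 : 0 ≤ C := (abs_nonneg _).trans h1
      have h2 : v ≤ T := hv.2
      simp only
      gcongr
  obtain ⟨X, hX⟩ := hXex
  obtain ⟨Y, hY⟩ := hYex
  have hexp : ∀ t, Real.exp (γ * (t - s)) * Real.exp (-γ * (t - s)) = 1 := by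
    intro t; rw [← Real.exp_add]; simp
  have toB : ∀ (q K t : ℝ), q * Real.exp (γ * (t - s)) ≤ K → q ≤ K * Real.exp (-γ * (t - s)) := by
    intro q K t hq
    have := mul_le_mul_of_nonneg_right hq (Real.exp_pos (-γ * (t - s))).le
    rwa [mul_assoc, hexp, mul_one] at this
  have ofB : ∀ (q K t : ℝ), q ≤ K * Real.exp (-γ * (t - s)) → q * Real.exp (γ * (t - s)) ≤ K := by
    intro q K t hq
    have := mul_le_mul_of_nonneg_right hq (Real.exp_pos (γ * (t - s))).le
    rwa [mul_assoc, mul_comm (Real.exp (-γ * (t - s))), hexp, mul_one] at this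
  have hXb : ∀ t ∈ Set.Icc s T, |x t| ≤ X * Real.exp (-γ * (t - s)) :=
    fun t ht => toB _ _ _ (hX.1 (Set.mem_image_of_mem _ ht))
  have hYb : ∀ t ∈ Set.Icc s T, |deriv x t| ≤ Y * Real.exp (-γ * (t - s)) :=
    fun t ht => toB _ _ _ (hY.1 (Set.mem_image_of_mem _ ht))
  have hX0 : 0 ≤ X := by
    have := (abs_nonneg _).trans (hXb s hsm)
    simpa using this
  have hY0 : 0 ≤ Y := by
    have := (abs_nonneg _).trans (hYb s hsm)
    simpa using this
  set κ := Real.exp (γ * (σ + τ)) with hκ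
  have hκ0 : 0 < κ := Real.exp_pos _
  have hκ1 : 1 ≤ κ := Real.one_le_exp (by positivity)
  have hden : 0 < 1 - γ / b0 := by
    rw [sub_pos, div_lt_one hb0]; exact hγb
  have hden1 : 1 - γ / b0 ≤ 1 := by
    have : 0 ≤ γ / b0 := by positivity
    linarith
  have hνκ : κ ≤ ν := by
    rw [hν, le_div_iff₀ hden]
    nlinarith
  have hνd : ν * (1 - γ / b0) = κ := by
    rw [hν]; exact div_mul_cancel₀ _ hden.ne'
  have hshift : ∀ t u : ℝ, t - u ≤ σ + τ →
      Real.exp (-γ * (u - s)) ≤ κ * Real.exp (-γ * (t - s)) := by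
    intro t u htu
    rw [hκ, ← Real.exp_add]
    apply Real.exp_le_exp.2
    nlinarith
  have hone : ∀ t u : ℝ, t - u ≤ σ + τ → u ≤ s → 1 ≤ κ * Real.exp (-γ * (t - s)) := by
    intro t u htu hu
    have h1 := hshift t u htu
    have h2 : 1 ≤ Real.exp (-γ * (u - s)) := Real.one_le_exp (by nlinarith)
    linarith
  have hgood : ∀ᵐ t : ℝ ∂volume, t ∈ Set.Icc s T →
      b0 ≤ b t ∧ b t ≤ B ∧ |a t| ≤ A0 ∧ |a t| ≤ R * b t ∧
      |Dfun x ψ s (g t)| ≤ κ * (Y + N) * Real.exp (-γ * (t - s)) ∧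
      |x (h t)| ≤ κ * (X + N) * Real.exp (-γ * (t - s)) ∧
      deriv x t = a t * Dfun x ψ s (g t) - b t * x (h t) ∧
      ∃ r, s ≤ r ∧ r ≤ t ∧ t - r ≤ 1 / (B * Real.exp 1) ∧
        |x r - x (h t)| ≤ κ * (S * Y + 2 * N) * Real.exp (-γ * (t - s)) := by
    filter_upwards [hgdel, hhdel, hae, hx4] with t h1 h2 h3 h4 ht
    have htt : t0 ≤ t := hs.trans ht.1
    obtain ⟨hg0, hg1⟩ := h1 htt
    obtain ⟨hh0, hh1⟩ := h2 htt
    obtain ⟨k1, k2, k3, k4, k5⟩ := h3 htt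
    have hbt : 0 < b t := hb0.trans_le k1
    have k6 := (le_max_left _ _).trans k5
    have h4' := h4 ht.1
    have hE := Real.exp_pos (-γ * (t - s))
    refine ⟨k1, k2, k3, (div_le_iff₀ hbt).1 k4, ?_, ?_, ?_, ?_⟩
    · unfold Dfun
      split_ifs with hc
      · have e1 := hYb (g t) ⟨hc, by linarith [ht.2]⟩
        have e2 := mul_le_mul_of_nonneg_left (hshift t (g t) (by linarith)) hY0
        have e3 : 0 ≤ N * (κ * Real.exp (-γ * (t - s))) := by positivity
        linarith
      · push Not at hc
        have e1 := hψ (g t) hc.le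
        have e2 := mul_le_mul_of_nonneg_left (hone t (g t) (by linarith) hc.le) hN
        have e3 : 0 ≤ Y * (κ * Real.exp (-γ * (t - s))) := by positivity
        linarith
    · by_cases hc : s ≤ h t
      · have e1 := hXb (h t) ⟨hc, by linarith [ht.2]⟩
        have e2 := mul_le_mul_of_nonneg_left (hshift t (h t) (by linarith)) hX0
        have e3 : 0 ≤ N * (κ * Real.exp (-γ * (t - s))) := by positivity
        linarith
      · push Not at hc
        have e1 := hφ (h t) hc.le
        rw [← hx1 _ hc.le] at e1
        have e2 := mul_le_mul_of_nonneg_left (hone t (h t) (by linarith) hc.le) hN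
        have e3 : 0 ≤ X * (κ * Real.exp (-γ * (t - s))) := by positivity
        linarith
    · have : Dfun x ψ s t = deriv x t := by simp [Dfun, ht.1]
      rw [this] at h4'
      linarith
    · have hδ : 0 < 1 / (B * Real.exp 1) := by positivity
      set δ := 1 / (B * Real.exp 1) with hδd
      -- derivative bound on a subinterval
      have hlip : ∀ u v, s ≤ u → u ≤ v → v ≤ t → t - u ≤ τ →
          |x v - x u| ≤ κ * Y * Real.exp (-γ * (t - s)) * (v - u) := by
        intro u v hu huv hvt htu
        apply aux_lip x u v _ huv
        · intro w hw
          exact hx2 w (hu.trans hw.1)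
        · intro w hw
          have e1 := hYb w ⟨hu.trans hw.1, (hw.2.trans hvt).trans ht.2⟩
          have e2 := mul_le_mul_of_nonneg_left (hshift t w (by linarith [hw.1])) hY0
          linarith
      have hNN : 0 ≤ N * (κ * Real.exp (-γ * (t - s))) := by positivity
      have hYE : 0 ≤ κ * Y * Real.exp (-γ * (t - s)) := by positivity
      by_cases hc : s ≤ h t
      · refine ⟨max (h t) (t - δ), hc.trans (le_max_left _ _), max_le (by linarith) (by linarith),
          by linarith [le_max_right (h t) (t - δ)], ?_⟩
        have e1 := hlip (h t) (max (h t) (t - δ)) hc (le_max_left _ _)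
          (max_le (by linarith) (by linarith)) hh1
        have e2 : max (h t) (t - δ) - h t ≤ S := by
          have : max (h t) (t - δ) ≤ S + h t := max_le (by linarith) (by linarith)
          linarith
        have e3 := mul_le_mul_of_nonneg_left e2 hYE
        linarith
      · push Not at hc
        have e0 : max s (t - δ) ≤ t := max_le ht.1 (by linarith)
        refine ⟨max s (t - δ), le_max_left _ _, e0,
          by linarith [le_max_right s (t - δ)], ?_⟩
        have e1 := hlip s (max s (t - δ)) le_rfl (le_max_left _ _) e0 (by linarith)
        have e2 : max s (t - δ) - s ≤ S := by
          have : max s (t - δ) ≤ S + s := max_le (by linarith) (by linarith)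
          linarith
        have e3 := mul_le_mul_of_nonneg_left e2 hYE
        have e4 := hφ (h t) hc.le
        rw [← hx1 _ hc.le] at e4
        have e5 := hφ s le_rfl
        rw [← hx1 _ le_rfl] at e5
        have e6 := mul_le_mul_of_nonneg_left (hone t (h t) (by linarith) hc.le) hN
        have e7 : |x (max s (t - δ)) - x (h t)| ≤
            |x (max s (t - δ)) - x s| + (|x s| + |x (h t)|) := by
          have := abs_add_le (x (max s (t - δ)) - x s) (x s - x (h t))
          have h9 := abs_sub (x s) (x (h t))
          rw [sub_add_sub_cancel] at this
          linarith
        linarith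
  refine ⟨X, Y, hXb, hY0, ?_, ?_⟩
  · -- derivative estimate
    have hYle : Y ≤ κ * (A0 * (Y + N) + B * (X + N)) := by
      have haeb : ∀ᵐ v : ℝ ∂volume, v ∈ Set.Icc s T → |deriv x v| ≤
          (κ * (A0 * (Y + N) + B * (X + N))) * Real.exp (-γ * (v - s)) := by
        filter_upwards [hgood] with v hv hvm
        obtain ⟨k1, k2, k3, -, k5, k6, k7, -⟩ := hv hvm
        have hbt : 0 ≤ b v := hb0.le.trans k1
        rw [k7]
        have e1 : |a v * Dfun x ψ s (g v)| ≤ A0 * (κ * (Y + N) * Real.exp (-γ * (v - s))) := by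
          rw [abs_mul]; gcongr
        have e2 : |b v * x (h v)| ≤ B * (κ * (X + N) * Real.exp (-γ * (v - s))) := by
          rw [abs_mul, abs_of_nonneg hbt]; gcongr
        refine (abs_sub _ _).trans ((add_le_add e1 e2).trans (le_of_eq ?_))
        ring
      apply hY.2
      rintro _ ⟨v, hv, rfl⟩
      apply ofB
      rw [abs_le']
      refine ⟨?_, ?_⟩
      · refine aux_everywhere x s T C _ γ hT hγ hd hC ?_ v hv
        filter_upwards [haeb] with w hw hwm
        exact (le_abs_self _).trans (hw hwm)
      · have e : ∀ w, deriv (fun y => -x y) w = -deriv x w := fun w => deriv.fun_neg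
        rw [← e v]
        refine aux_everywhere (fun y => -x y) s T C _ γ hT hγ (fun w hw => (hd w hw).fun_neg)
          ?_ ?_ v hv
        · intro w hw
          rw [e w, abs_neg]
          exact hC w hw
        · filter_upwards [haeb] with w hw hwm
          rw [e w]
          exact (neg_le_abs _).trans (hw hwm)
    have : κ * (A0 * (Y + N) + B * (X + N)) ≤ ν * (A0 * (Y + N) + B * (X + N)) := by
      gcongr
    linarith
  · -- the comparison argument
    set P := ν * (R * (Y + N) + S * Y + 2 * N) + N with hP
    have hν0 : 0 < ν := hκ0.trans_le hνκ
    have hP0 : 0 ≤ P := by positivity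
    have hPQ : κ * (R * (Y + N) + S * Y + 2 * N) ≤ P * (1 - γ / b0) := by
      have e1 : P * (1 - γ / b0) = ν * (1 - γ / b0) * (R * (Y + N) + S * Y + 2 * N)
        + N * (1 - γ / b0) := by rw [hP]; ring
      rw [e1, hνd]
      have : 0 ≤ N * (1 - γ / b0) := by positivity
      linarith
    have hpder : ∀ v, HasDerivAt (fun v => P * Real.exp (-γ * (v - s)))
        (P * (Real.exp (-γ * (v - s)) * (-γ))) v := by
      intro v
      have h1 : HasDerivAt (fun v : ℝ => -γ * (v - s)) (-γ) v := by
        simpa using ((hasDerivAt_id v).sub_const s).const_mul (-γ)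
      exact (h1.exp).const_mul P
    have hcmp : ∀ ε : ℝ, |ε| = 1 → ∀ t ∈ Set.Icc s T, 0 ≤ P * Real.exp (-γ * (t - s)) - ε * x t := by
      intro ε hε
      have hzder : ∀ v ∈ Set.Icc s T, HasDerivAt (fun v => P * Real.exp (-γ * (v - s)) - ε * x v)
          (P * (Real.exp (-γ * (v - s)) * (-γ)) - ε * deriv x v) v := by
        intro v hv
        exact (hpder v).sub ((hd v hv).hasDerivAt.const_mul ε)
      refine aux_pos (fun v => P * Real.exp (-γ * (v - s)) - ε * x v) s T (P * γ + C) B hB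
        (fun v hv => (hzder v hv).differentiableAt) ?_ ?_ ?_
      · intro v hv
        rw [(hzder v hv).deriv]
        refine (abs_sub _ _).trans (add_le_add ?_ ?_)
        · rw [abs_mul, abs_mul, abs_neg, abs_of_nonneg hP0, abs_of_pos hγ,
            abs_of_pos (Real.exp_pos _)]
          have : Real.exp (-γ * (v - s)) ≤ 1 := by
            apply Real.exp_le_one_iff.2
            nlinarith [hv.1]
          have h2 : Real.exp (-γ * (v - s)) * γ ≤ 1 * γ := by gcongr
          have h3 := mul_le_mul_of_nonneg_left h2 hP0
          linarith
        · rw [abs_mul, hε, one_mul]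
          exact hC v hv
      · have e5 := hφ s le_rfl
        rw [← hx1 _ le_rfl] at e5
        have e6 : ε * x s ≤ |x s| := by
          have := le_abs_self (ε * x s)
          rwa [abs_mul, hε, one_mul] at this
        have e7 : N ≤ P := by
          have : 0 ≤ ν * (R * (Y + N) + S * Y + 2 * N) := by positivity
          linarith
        simp only [sub_self, mul_zero, Real.exp_zero, mul_one]
        linarith
      · filter_upwards [hgood] with v hv hvm
        obtain ⟨k1, k2, k3, k4, k5, k6, k7, r, hr1, hr2, hr3, hr4⟩ := hv hvm
        refine ⟨r, b v, hr1, hr2, hr3, hb0.le.trans k1, k2, ?_⟩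
        rw [(hzder v hvm).deriv]
        have hbt : 0 < b v := hb0.trans_le k1
        have hE := Real.exp_pos (-γ * (v - s))
        set E := Real.exp (-γ * (v - s)) with hEd
        have e1 : E ≤ Real.exp (-γ * (r - s)) := by
          apply Real.exp_le_exp.2
          nlinarith
        have e2 : b v * (P * E) ≤ b v * (P * Real.exp (-γ * (r - s))) := by gcongr
        have e3 : |deriv x v + b v * x r| ≤
            b v * (κ * (R * (Y + N) + S * Y + 2 * N) * E) := by
          have f1 : deriv x v + b v * x r =
              a v * Dfun x ψ s (g v) + b v * (x r - x (h v)) := by rw [k7]; ring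
          have f2 : |a v * Dfun x ψ s (g v)| ≤ (R * b v) * (κ * (Y + N) * E) := by
            rw [abs_mul]; gcongr
          have f3 : |b v * (x r - x (h v))| ≤ b v * (κ * (S * Y + 2 * N) * E) := by
            rw [abs_mul, abs_of_pos hbt]; gcongr
          rw [f1]
          refine (abs_add_le _ _).trans ((add_le_add f2 f3).trans (le_of_eq ?_))
          ring
        have e4 : ε * (deriv x v + b v * x r) ≤ |deriv x v + b v * x r| := by
          have := le_abs_self (ε * (deriv x v + b v * x r))
          rwa [abs_mul, hε, one_mul] at this
        have e5 : b v * (κ * (R * (Y + N) + S * Y + 2 * N) * E) ≤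
            b v * (P * (1 - γ / b0) * E) := by gcongr
        have e6 : γ ≤ b v * (γ / b0) := by
          have : b0 * (γ / b0) = γ := by field_simp
          have h2 : b0 * (γ / b0) ≤ b v * (γ / b0) := by gcongr
          linarith
        have e7 := mul_le_mul_of_nonneg_right e6 (mul_nonneg hP0 hE.le)
        have e8 : b v * (P * (1 - γ / b0) * E) = b v * (P * E) - b v * (γ / b0) * (P * E) := by
          ring
        have e9 : P * (E * -γ) = - (γ * (P * E)) := by ring
        rw [e9]
        linarith
    have hXP : X ≤ P := by
      apply hX.2
      rintro _ ⟨v, hv, rfl⟩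
      apply ofB
      rw [abs_le']
      have h1 := hcmp 1 (by simp) v hv
      have h2 := hcmp (-1) (by simp) v hv
      constructor <;> linarith
    have hν1 : 1 ≤ ν := hκ1.trans hνκ
    have : N ≤ ν * N := le_mul_of_one_le_left hN hν1
    rw [hP] at hXP
    linarith

/-- Condition (5.3) of Proposition 5.1, where `u⁺ = max {u, 0}`. -/
theorem proposition5_1_condition3
    (t0 : ℝ) (ht0 : 0 ≤ t0) (σ τ : ℝ) (hσ : 0 < σ) (hτ : 0 < τ)
    (a b g h : ℝ → ℝ)
    (ham : Measurable a) (hbm : Measurable b) (hgm : Measurable g) (hhm : Measurable h)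
    (hgdel : ∀ᵐ t : ℝ ∂volume, t0 ≤ t → 0 ≤ t - g t ∧ t - g t ≤ σ)
    (hhdel : ∀ᵐ t : ℝ ∂volume, t0 ≤ t → 0 ≤ t - h t ∧ t - h t ≤ τ)
    (b0 B A0 R S : ℝ) (hb0 : 0 < b0) (hB : 0 < B) (hA0 : 0 ≤ A0) (hA0' : A0 < 1)
    (hR : 0 ≤ R) (hS : 0 ≤ S)
    (hae : ∀ᵐ t : ℝ ∂volume, t0 ≤ t →
      b0 ≤ b t ∧ b t ≤ B ∧ |a t| ≤ A0 ∧ |a t| / b t ≤ R ∧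
      max (t - h t - 1 / (B * Real.exp 1)) 0 ≤ S)
    (hcond : B * (R + S) < 1 - A0) :
    UnifExpStable1 a b g h t0 := by
  obtain ⟨γ, hγ, hγb, hlt⟩ := aux_gamma σ τ b0 B A0 R S hb0 hcond
  obtain ⟨ν, hν⟩ : ∃ ν, ν = Real.exp (γ * (σ + τ)) / (1 - γ / b0) := ⟨_, rfl⟩
  rw [← hν] at hlt
  have hden : 0 < 1 - γ / b0 := by
    rw [sub_pos, div_lt_one hb0]; exact hγb
  have hν0 : 0 < ν := by rw [hν]; positivity
  set d := 1 - (ν ^ 2 * (B * (R + S)) + ν * A0) with hd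
  have hd0 : 0 < d := by linarith
  set c1 := ν * (B * (ν * (R + 3)) + (A0 + B)) with hc1
  have hc10 : 0 ≤ c1 := by positivity
  refine ⟨ν * ((R + S) * (c1 / d) + (R + 3)), by positivity, γ, hγ, ?_⟩
  intro s hs φ ψ x hφ hψ hx t ht
  set N := ⨆ u : {u : ℝ // u ≤ s}, (|φ u.1| + |ψ u.1|) with hN
  have hle : ∀ u ≤ s, |φ u| + |ψ u| ≤ N := by
    intro u hu
    obtain ⟨C1, hC1⟩ := hφ
    obtain ⟨C2, hC2⟩ := hψ
    have hb : BddAbove (Set.range fun u : {u : ℝ // u ≤ s} => |φ u.1| + |ψ u.1|) := by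
      refine ⟨C1 + C2, ?_⟩
      rintro _ ⟨u, rfl⟩
      exact add_le_add (hC1 _) (hC2 _)
    exact le_ciSup hb ⟨u, hu⟩
  obtain ⟨X, Y, h1, hY0, h2, h3⟩ := aux_core t0 σ τ hσ hτ a b g h hgdel hhdel b0 B A0 R S hb0 hB
    hA0 hR hS hae γ ν hγ hγb hν s hs φ ψ x N
    (fun u hu => by linarith [hle u hu, abs_nonneg (ψ u)])
    (fun u hu => by linarith [hle u hu, abs_nonneg (φ u)]) hx (t + 1) (by linarith)
  have hYd : Y ≤ c1 / d * N := by
    have e1 : ν * B * X ≤ ν * B * (ν * ((R + S) * Y + (R + 3) * N)) := by gcongr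
    have e2 : Y * d ≤ c1 * N := by
      rw [hd, hc1]
      linarith
    rw [div_mul_eq_mul_div, le_div_iff₀ hd0]
    exact e2
  have hXN : X ≤ ν * ((R + S) * (c1 / d) + (R + 3)) * N := by
    have e1 : ν * ((R + S) * Y + (R + 3) * N) ≤
        ν * ((R + S) * (c1 / d * N) + (R + 3) * N) := by gcongr
    linarith
  have hf := h1 t ⟨ht, by linarith⟩
  have e1 := mul_le_mul_of_nonneg_right hXN (Real.exp_pos (-γ * (t - s))).le
  linarith
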